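/- arXiv:2401.14839 — 4 statements merged into one kernel-verified Lean document; each statement's English description precedes it below -/
import Mathlib

section
/- Logarithmic Gronwall inequality (Lemma 9.2 / lem-gronwall): Let α ≥ 1, let h₁, h₂ : [0,∞) → ℝ be nonnegative and locally integrable, and let y : [0,∞) → ℝ be nonnegative, continuous, and differentiable on (0,∞) with y'(t) ≤ h₁(t)·y(t) + h₂(t)·log(α + y(t))·y(t) for every t > 0. Then for all 0 ≤ t₁ ≤ t₂ < ∞ one has y(t₂) ≤ exp( (log(α + y(t₁)) + ∫_{t₁}^{t₂} h₁(τ) dτ) · exp(∫_{t₁}^{t₂} h₂(τ) dτ) ). -/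
open MeasureTheory Real

theorem lg_exp_lip (u v : ℝ) (hu : 0 ≤ u) (hv : 0 ≤ v) :
    dist (Real.exp (-u)) (Real.exp (-v)) ≤ dist u v := by
  wlog h : u ≤ v generalizing u v
  · rw [dist_comm, dist_comm u]
    exact this v u hv hu (le_of_not_ge h)
  have h1 : Real.exp (-v) ≤ Real.exp (-u) := Real.exp_le_exp.2 (by linarith)
  rw [Real.dist_eq, Real.dist_eq, abs_of_nonneg (by linarith), abs_of_nonpos (by linarith)]
  have h2 : Real.exp (-v) = Real.exp (-u) * Real.exp (u - v) := by
    rw [← Real.exp_add]; congr 1; ring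
  have h3 := Real.add_one_le_exp (u - v)
  have h4 : Real.exp (-u) ≤ 1 := Real.exp_le_one_iff.2 (by linarith)
  have h5 := Real.exp_pos (-u)
  rw [h2]
  nlinarith

theorem lg_ac_exp {f : ℝ → ℝ} {a b : ℝ} (hab : a ≤ b) (hf : AbsolutelyContinuousOnInterval f a b)
    (h0 : ∀ x ∈ Set.Icc a b, 0 ≤ f x) :
    AbsolutelyContinuousOnInterval (fun x => Real.exp (-f x)) a b := by
  rw [absolutelyContinuousOnInterval_iff] at hf ⊢
  intro ε hε
  obtain ⟨δ, hδ, H⟩ := hf ε hε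
  refine ⟨δ, hδ, fun E hE hE2 => lt_of_le_of_lt (Finset.sum_le_sum fun i hi => ?_) (H E hE hE2)⟩
  have := hE.1 i hi
  rw [Set.uIcc_of_le hab] at this
  exact lg_exp_lip _ _ (h0 _ this.1) (h0 _ this.2)

theorem lg_integral_gronwall {a b A : ℝ} (hab : a ≤ b) {h z : ℝ → ℝ}
    (hh : IntervalIntegrable h volume a b) (h0 : ∀ t ∈ Set.Icc a b, 0 ≤ h t)
    (hz : ContinuousOn z (Set.Icc a b))
    (hle : ∀ t ∈ Set.Icc a b, z t ≤ A + ∫ τ in a..t, h τ * z τ) :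
    z b ≤ A * Real.exp (∫ τ in a..b, h τ) := by
  have hu : Set.uIcc a b = Set.Icc a b := Set.uIcc_of_le hab
  have hhz : IntervalIntegrable (fun τ => h τ * z τ) volume a b :=
    hh.mul_continuousOn (by rwa [hu])
  have ha : a ∈ Set.uIcc a b := Set.left_mem_uIcc
  have hH := hh.absolutelyContinuousOnInterval_intervalIntegral ha
  have hV := hhz.absolutelyContinuousOnInterval_intervalIntegral ha
  have hc : AbsolutelyContinuousOnInterval (fun _ : ℝ => A) a b :=
    ((LipschitzWith.const A).lipschitzOnWith (s := Set.uIcc a b)).absolutelyContinuousOnInterval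
  have hW : AbsolutelyContinuousOnInterval (fun x => A + ∫ τ in a..x, h τ * z τ) a b :=
    hc.fun_add hV
  have hG := lg_ac_exp hab hH (fun x hx => intervalIntegral.integral_nonneg hx.1
    fun u hu => h0 u ⟨hu.1, hu.2.trans hx.2⟩)
  have key := hW.integral_deriv_mul_eq_sub hG
  have hneg : (∫ x in a..b, (deriv (fun x => A + ∫ τ in a..x, h τ * z τ) x *
      Real.exp (-∫ τ in a..x, h τ) + (A + ∫ τ in a..x, h τ * z τ) *
      deriv (fun x => Real.exp (-∫ τ in a..x, h τ)) x)) ≤ 0 := by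
    rw [intervalIntegral.integral_of_le hab]
    apply integral_nonpos_of_ae
    rw [Filter.EventuallyLE, ae_restrict_iff' measurableSet_Ioc]
    filter_upwards [hh.ae_hasDerivAt_integral, hhz.ae_hasDerivAt_integral] with x h1 h2 hx
    have hx' : x ∈ Set.Icc a b := ⟨hx.1.le, hx.2⟩
    have d1 := h1 (hu ▸ hx') a ha
    have d2 := h2 (hu ▸ hx') a ha
    rw [(d2.const_add A).deriv, d1.fun_neg.exp.deriv]
    have e1 := hle x hx'
    have e2 := mul_nonneg (h0 x hx') (Real.exp_pos (-∫ τ in a..x, h τ)).le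
    simp only [Pi.zero_apply, Pi.neg_apply]
    nlinarith
  rw [key] at hneg
  simp only [intervalIntegral.integral_same, neg_zero, Real.exp_zero, add_zero, mul_one] at hneg
  have hb := hle b ⟨hab, le_rfl⟩
  refine hb.trans ?_
  rw [Real.exp_neg, sub_nonpos, ← div_eq_mul_inv, div_le_iff₀ (Real.exp_pos _)] at hneg
  exact hneg

/-- **Logarithmic Gronwall inequality** (Lemma 9.2 / `lem-gronwall`).
If `α ≥ 1`, `h₁, h₂` are nonnegative and locally integrable on `[0,∞)`, `y` is nonnegative,
continuous on `[0,∞)` and differentiable on `(0,∞)` with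
`y' t ≤ h₁ t * y t + h₂ t * log (α + y t) * y t` for `t > 0`, then for `0 ≤ t₁ ≤ t₂` one has
`y t₂ ≤ exp ((log (α + y t₁) + ∫_{t₁}^{t₂} h₁) * exp (∫_{t₁}^{t₂} h₂))`. -/
theorem log_gronwall
    (α : ℝ) (hα : 1 ≤ α)
    (h₁ h₂ y y' : ℝ → ℝ)
    (hh₁nonneg : ∀ t, 0 ≤ t → 0 ≤ h₁ t)
    (hh₂nonneg : ∀ t, 0 ≤ t → 0 ≤ h₂ t)
    (hynonneg : ∀ t, 0 ≤ t → 0 ≤ y t)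
    (hh₁loc : LocallyIntegrableOn h₁ (Set.Ici (0 : ℝ)))
    (hh₂loc : LocallyIntegrableOn h₂ (Set.Ici (0 : ℝ)))
    (hycont : ContinuousOn y (Set.Ici (0 : ℝ)))
    (hyderiv : ∀ t, 0 < t → HasDerivAt y (y' t) t)
    (hineq : ∀ t, 0 < t → y' t ≤ h₁ t * y t + h₂ t * Real.log (α + y t) * y t) :
    ∀ t₁ t₂ : ℝ, 0 ≤ t₁ → t₁ ≤ t₂ →
      y t₂ ≤ Real.exp ((Real.log (α + y t₁) + ∫ τ in t₁..t₂, h₁ τ) *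
        Real.exp (∫ τ in t₁..t₂, h₂ τ)) := by
  intro t₁ t₂ ht₁ ht
  have hsub : ∀ t, Set.Icc t₁ t ⊆ Set.Ici (0 : ℝ) := fun t x hx => ht₁.trans hx.1
  have i1 : ∀ t, IntegrableOn h₁ (Set.Icc t₁ t) := fun t =>
    hh₁loc.integrableOn_compact_subset (hsub t) isCompact_Icc
  have i2 : ∀ t, IntegrableOn h₂ (Set.Icc t₁ t) := fun t =>
    hh₂loc.integrableOn_compact_subset (hsub t) isCompact_Icc
  have hpos : ∀ t, 0 ≤ t → 0 < α + y t := fun t h => by linarith [hynonneg t h]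
  have hzc : ContinuousOn (fun t => Real.log (α + y t)) (Set.Ici 0) :=
    (continuousOn_const.add hycont).log fun t h => (hpos t h).ne'
  have ii1 : ∀ t, t₁ ≤ t → IntervalIntegrable h₁ volume t₁ t := fun t h =>
    (intervalIntegrable_iff_integrableOn_Icc_of_le h).2 (i1 t)
  have ii2 : ∀ t, t₁ ≤ t → IntervalIntegrable h₂ volume t₁ t := fun t h =>
    (intervalIntegrable_iff_integrableOn_Icc_of_le h).2 (i2 t)
  have ii3 : ∀ t, t₁ ≤ t →
      IntervalIntegrable (fun τ => h₂ τ * Real.log (α + y τ)) volume t₁ t := fun t h =>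
    (ii2 t h).mul_continuousOn (by rw [Set.uIcc_of_le h]; exact hzc.mono (hsub t))
  have hmain := lg_integral_gronwall (z := fun t => Real.log (α + y t))
    (A := Real.log (α + y t₁) + ∫ τ in t₁..t₂, h₁ τ) ht (ii2 t₂ ht)
    (fun t h => hh₂nonneg t (hsub _ h)) (hzc.mono (hsub t₂)) (by
      intro t h
      have hd := intervalIntegral.sub_le_integral_of_hasDeriv_right_of_le
        (g := fun t => Real.log (α + y t)) (g' := fun t => y' t / (α + y t))
        (φ := fun τ => h₁ τ + h₂ τ * Real.log (α + y τ)) h.1 (hzc.mono (hsub t))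
        (fun x hx => by
          have hx0 : 0 < x := ht₁.trans_lt hx.1
          exact (((hyderiv x hx0).const_add α).log (hpos x hx0.le).ne').hasDerivWithinAt)
        ((intervalIntegrable_iff_integrableOn_Icc_of_le h.1).1 ((ii1 t h.1).add (ii3 t h.1)))
        (fun x hx => by
          have hx0 : 0 < x := ht₁.trans_lt hx.1
          have hy := hynonneg x hx0.le
          rw [div_le_iff₀ (hpos x hx0.le)]
          have l0 : 0 ≤ Real.log (α + y x) := Real.log_nonneg (by linarith)
          have p1 := hh₁nonneg x hx0.le
          have p2 := mul_nonneg (hh₂nonneg x hx0.le) l0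
          have := hineq x hx0
          nlinarith [mul_nonneg (add_nonneg p1 p2) (by linarith : (0:ℝ) ≤ α)])
      rw [intervalIntegral.integral_add (ii1 t h.1) (ii3 t h.1)] at hd
      have hmono : ∫ τ in t₁..t, h₁ τ ≤ ∫ τ in t₁..t₂, h₁ τ := by
        have hr : IntervalIntegrable h₁ volume t t₂ := (ii1 t h.1).symm.trans (ii1 t₂ ht)
        rw [← intervalIntegral.integral_add_adjacent_intervals (ii1 t h.1) hr]
        have := intervalIntegral.integral_nonneg (μ := volume) (f := h₁) h.2
          (fun u hu => hh₁nonneg u (ht₁.trans (h.1.trans hu.1)))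
        linarith
      linarith)
  have h2 : 0 ≤ t₂ := ht₁.trans ht
  calc y t₂ ≤ α + y t₂ := by linarith
    _ = Real.exp (Real.log (α + y t₂)) := (Real.exp_log (hpos t₂ h2)).symm
    _ ≤ _ := Real.exp_le_exp.2 hmain
end

section
/- Sobolev product estimate (inequality (So-paraproduct)): Let d ≥ 1 and s₁, s₂ ∈ (0, d/2). There is a constant C = C(d, s₁, s₂) > 0 such that for all Schwartz functions f, g : ℝ^d → ℂ, ( ∫_{ℝ^d} (1+|ξ|²)^{s₁+s₂−d/2} |𝓕(fg)(ξ)|² dξ )^{1/2} ≤ C · ( ∫_{ℝ^d} (1+|ξ|²)^{s₁} |𝓕f(ξ)|² dξ )^{1/2} · ( ∫_{ℝ^d} (1+|ξ|²)^{s₂} |𝓕g(ξ)|² dξ )^{1/2}; that is, ‖fg‖_{H^{s₁+s₂−d/2}} ≤ C‖f‖_{H^{s₁}}‖g‖_{H^{s₂}}. -/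
open MeasureTheory FourierTransform Real
open scoped ENNReal NNReal

namespace SobProd

/-- The `L²` size of a nonnegative function. -/
noncomputable def N2 {E : Type*} [MeasureSpace E] (F : E → ℝ≥0∞) : ℝ≥0∞ :=
  (∫⁻ x, F x ^ (2 : ℝ)) ^ ((1 : ℝ) / 2)

lemma N2_rpow {E : Type*} [MeasureSpace E] (F : E → ℝ≥0∞) :
    N2 F ^ (2 : ℝ) = ∫⁻ x, F x ^ (2 : ℝ) := by
  unfold N2
  rw [← ENNReal.rpow_mul]; norm_num

lemma cs {E : Type*} [MeasureSpace E] {f g : E → ℝ≥0∞} (hf : Measurable f) (hg : Measurable g) :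
    ∫⁻ x, f x * g x ≤ N2 f * N2 g :=
  ENNReal.lintegral_mul_le_Lp_mul_Lq volume Real.HolderConjugate.two_two
    hf.aemeasurable hg.aemeasurable

section abs
variable {d : ℕ}

lemma trilin {k : EuclideanSpace ℝ (Fin d) → EuclideanSpace ℝ (Fin d) → ℝ≥0∞}
    (hk : Measurable (fun p : EuclideanSpace ℝ (Fin d) × EuclideanSpace ℝ (Fin d) => k p.1 p.2))
    {K : ℝ≥0∞} (hK : ∀ x, ∫⁻ y, k x y ^ (2 : ℝ) ≤ K)
    {F G H : EuclideanSpace ℝ (Fin d) → ℝ≥0∞}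
    (hF : Measurable F) (hG : Measurable G) (hH : Measurable H) :
    ∫⁻ x, ∫⁻ y, k x y * (F (x - y) * G y * H x) ≤
      K ^ ((1 : ℝ) / 2) * (N2 F * N2 G * N2 H) := by
  have hm : Measurable (fun p : EuclideanSpace ℝ (Fin d) × EuclideanSpace ℝ (Fin d) =>
      F (p.1 - p.2) * G p.2) := by fun_prop
  have hmx : ∀ x, Measurable (fun y => F (x - y) * G y) := fun x => by fun_prop
  have hkx : ∀ x, Measurable (fun y => k x y) := fun x => hk.comp measurable_prodMk_left
  have hP : Measurable (fun x => N2 (fun y => F (x - y) * G y)) := by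
    unfold N2
    apply Measurable.pow_const
    exact Measurable.lintegral_prod_right' (f := fun p => (F (p.1 - p.2) * G p.2) ^ (2:ℝ))
      (hm.pow_const _)
  have hN : N2 (fun x => N2 (fun y => F (x - y) * G y)) = N2 F * N2 G := by
    have : ∫⁻ x, N2 (fun y => F (x - y) * G y) ^ (2:ℝ) =
        (∫⁻ x, F x ^ (2:ℝ)) * ∫⁻ x, G x ^ (2:ℝ) := by
      simp_rw [N2_rpow]
      rw [lintegral_lintegral_swap (hm.pow_const _).aemeasurable]
      simp_rw [ENNReal.mul_rpow_of_nonneg _ _ (zero_le_two : (0:ℝ) ≤ 2)]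
      have h1 : ∀ y, ∫⁻ x, F (x - y) ^ (2:ℝ) * G y ^ (2:ℝ) =
          (∫⁻ x, F x ^ (2:ℝ)) * G y ^ (2:ℝ) := by
        intro y
        rw [lintegral_mul_const _ (by fun_prop),
          lintegral_sub_right_eq_self (fun x => F x ^ (2:ℝ)) y]
      simp_rw [h1]
      rw [lintegral_const_mul _ (by fun_prop)]
    rw [N2, this, ENNReal.mul_rpow_of_nonneg _ _ (by norm_num)]
    rfl
  calc ∫⁻ x, ∫⁻ y, k x y * (F (x - y) * G y * H x)
      ≤ ∫⁻ x, K ^ ((1 : ℝ) / 2) * (N2 (fun y => F (x - y) * G y) * H x) := by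
        apply lintegral_mono
        intro x
        simp only
        calc ∫⁻ y, k x y * (F (x - y) * G y * H x)
            = (∫⁻ y, k x y * (F (x - y) * G y)) * H x := by
              rw [← lintegral_mul_const _ (f := fun y => k x y * (F (x - y) * G y))
                ((hkx x).mul (hmx x))]
              simp_rw [mul_assoc]
          _ ≤ (K ^ ((1 : ℝ) / 2) * N2 (fun y => F (x - y) * G y)) * H x := by
              gcongr
              refine (cs (hkx x) (hmx x)).trans ?_
              gcongr
              exact ENNReal.rpow_le_rpow (hK x) (by norm_num)
          _ = _ := by ring
    _ = K ^ ((1 : ℝ) / 2) * ∫⁻ x, (N2 (fun y => F (x - y) * G y) * H x) :=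
        lintegral_const_mul _ (hP.mul hH)
    _ ≤ _ := by
        gcongr
        refine (cs hP hH).trans ?_
        rw [hN]
end abs

/-- Bracket -/
noncomputable def J {d : ℕ} (x : EuclideanSpace ℝ (Fin d)) : ℝ := 1 + ‖x‖ ^ 2

lemma J_pos {d : ℕ} (x : EuclideanSpace ℝ (Fin d)) : 0 < J x := by unfold J; positivity

lemma J_meas {d : ℕ} : Measurable (J (d := d)) := by unfold J; fun_prop

lemma J_neg {d : ℕ} (x : EuclideanSpace ℝ (Fin d)) : J (-x) = J x := by simp [J]

/-- Basic kernel -/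
noncomputable def ker {d : ℕ} (b : ℝ) (x y : EuclideanSpace ℝ (Fin d)) : ℝ≥0∞ :=
  if ‖y‖ ≤ ‖x‖ then ENNReal.ofReal (J y ^ (-b / 2) * J x ^ (-((d : ℝ) / 2 - b) / 2)) else 0

lemma ker_meas {d : ℕ} (b : ℝ) :
    Measurable (fun p : EuclideanSpace ℝ (Fin d) × EuclideanSpace ℝ (Fin d) =>
      ker b p.1 p.2) := by
  unfold ker
  refine Measurable.ite (measurableSet_le (by fun_prop) (by fun_prop)) ?_ measurable_const
  have := J_meas (d := d)
  fun_prop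

lemma phi_int {d : ℕ} (hd : 1 ≤ d) (b : ℝ) (hb : b < (d : ℝ) / 2) :
    ∫⁻ z in Metric.ball (0 : EuclideanSpace ℝ (Fin d)) 1,
      ENNReal.ofReal (1 + ‖z‖ ^ (-2 * b)) < ∞ := by
  have : Nonempty (Fin d) := ⟨⟨0, hd⟩⟩
  have h : IntegrableOn (fun z : EuclideanSpace ℝ (Fin d) => 1 + ‖z‖ ^ (-2 * b))
      (Metric.ball 0 1) := by
    refine Integrable.add ?_ ?_
    · exact integrableOn_const (measure_ball_lt_top.ne)
    · refine (integrableOn_fun_norm_addHaar volume (f := fun r => r ^ (-2 * b))).2 ?_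
      have : IntegrableOn (fun y : ℝ => y ^ ((d : ℝ) - 1 - 2 * b)) (Set.Ioo 0 1) := by
        rw [intervalIntegral.integrableOn_Ioo_rpow_iff one_pos]
        linarith
      refine this.congr_fun ?_ measurableSet_Ioo
      intro y hy
      simp only [finrank_euclideanSpace, Fintype.card_fin, smul_eq_mul]
      rw [← Real.rpow_natCast, ← Real.rpow_add hy.1, Nat.cast_sub hd]
      congr 1
      push_cast; ring
  exact h.lintegral_lt_top

lemma scale {d : ℕ} {R : ℝ} (hR : 0 < R) {f : EuclideanSpace ℝ (Fin d) → ℝ≥0∞}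
    (hf : Measurable f) :
    ∫⁻ y, f (R⁻¹ • y) = ENNReal.ofReal (R ^ d) * ∫⁻ z, f z := by
  have h := Measure.map_addHaar_smul (volume : Measure (EuclideanSpace ℝ (Fin d)))
    (inv_ne_zero hR.ne')
  rw [← lintegral_map (g := fun y : EuclideanSpace ℝ (Fin d) => R⁻¹ • y) hf (by fun_prop)]
  erw [h]
  rw [lintegral_smul_measure]
  simp [abs_of_pos hR]

lemma ker_int {d : ℕ} (hd : 1 ≤ d) (b : ℝ) (hb : b < (d : ℝ) / 2) :
    ∃ K : ℝ≥0∞, K < ∞ ∧ ∀ x : EuclideanSpace ℝ (Fin d), ∫⁻ y, ker b x y ^ (2 : ℝ) ≤ K := by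
  have : Nonempty (Fin d) := ⟨⟨0, hd⟩⟩
  refine ⟨_, phi_int hd b hb, fun x => ?_⟩
  set R : ℝ := √(J x) with hRdef
  have hR : 0 < R := Real.sqrt_pos.2 (J_pos x)
  have hR2 : R ^ 2 = J x := Real.sq_sqrt (J_pos x).le
  set f : EuclideanSpace ℝ (Fin d) → ℝ≥0∞ :=
    (Metric.ball (0 : EuclideanSpace ℝ (Fin d)) 1).indicator
      (fun z => ENNReal.ofReal (1 + ‖z‖ ^ (-2 * b))) with hfdef
  have hf : Measurable f := Measurable.indicator (by fun_prop) measurableSet_ball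
  have key : ∀ᵐ y : EuclideanSpace ℝ (Fin d),
      ker b x y ^ (2 : ℝ) ≤ ENNReal.ofReal (R ^ (-(d : ℝ))) * f (R⁻¹ • y) := by
    have h0 : ∀ᵐ y : EuclideanSpace ℝ (Fin d), y ≠ 0 := by
      simp [ae_iff]
    filter_upwards [h0] with y hy0
    unfold ker
    split_ifs with hxy
    swap
    · simp
    have hyR : ‖y‖ < R := by
      apply lt_of_le_of_lt hxy
      apply lt_of_pow_lt_pow_left₀ 2 hR.le
      rw [hR2, J]; linarith
    have hz : ‖R⁻¹ • y‖ = ‖y‖ / R := by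
      rw [norm_smul, norm_inv, Real.norm_of_nonneg hR.le]; field_simp
    have hmem : R⁻¹ • y ∈ Metric.ball (0 : EuclideanSpace ℝ (Fin d)) 1 := by
      rw [mem_ball_zero_iff, hz, div_lt_one hR]; exact hyR
    rw [hfdef, Set.indicator_of_mem hmem, hz, ENNReal.ofReal_rpow_of_nonneg
      (by have := J_pos x; have := J_pos y; positivity) (by norm_num),
      ← ENNReal.ofReal_mul (by positivity)]
    apply ENNReal.ofReal_le_ofReal
    have hyp : 0 < ‖y‖ := norm_pos_iff.2 hy0
    have e1 : (J y ^ (-b / 2) * J x ^ (-((d : ℝ) / 2 - b) / 2)) ^ (2 : ℝ) =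
        J y ^ (-b) * (R ^ (-(d : ℝ)) * R ^ (2 * b)) := by
      have := J_pos x; have := J_pos y
      rw [Real.mul_rpow (by positivity) (by positivity), ← Real.rpow_mul (by positivity),
        ← Real.rpow_mul (by positivity), ← hR2, ← Real.rpow_natCast, ← Real.rpow_mul hR.le,
        ← Real.rpow_add hR]
      congr 2 <;> push_cast <;> ring
    rw [e1]
    have e2 : J y ^ (-b) * R ^ (2 * b) ≤ 1 + (‖y‖ / R) ^ (-2 * b) := by
      rcases le_or_gt 0 b with hb0 | hb0
      · have : J y ^ (-b) ≤ (‖y‖ ^ 2) ^ (-b) := by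
          apply Real.rpow_le_rpow_of_nonpos (by positivity) _ (by linarith)
          unfold J; linarith
        have h2 : (‖y‖ ^ 2) ^ (-b) * R ^ (2 * b) = (‖y‖ / R) ^ (-2 * b) := by
          rw [Real.div_rpow hyp.le hR.le, ← Real.rpow_natCast, ← Real.rpow_mul hyp.le,
            div_eq_mul_inv, ← Real.rpow_neg hR.le]
          congr 2 <;> push_cast <;> ring
        have := mul_le_mul_of_nonneg_right this (Real.rpow_nonneg hR.le (2 * b))
        linarith
      · have : J y ^ (-b) ≤ (R ^ 2) ^ (-b) := by
          apply Real.rpow_le_rpow (J_pos y).le _ (by linarith)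
          rw [hR2]; unfold J; gcongr
        have h2 : (R ^ 2) ^ (-b) * R ^ (2 * b) = 1 := by
          rw [← Real.rpow_natCast, ← Real.rpow_mul hR.le, ← Real.rpow_add hR]
          convert Real.rpow_zero R using 2
          push_cast; ring
        have := mul_le_mul_of_nonneg_right this (Real.rpow_nonneg hR.le (2 * b))
        have : 0 ≤ (‖y‖ / R) ^ (-2 * b) := by positivity
        linarith
    calc _ = R ^ (-(d : ℝ)) * (J y ^ (-b) * R ^ (2 * b)) := by ring
      _ ≤ _ := by gcongr
  calc ∫⁻ y, ker b x y ^ (2 : ℝ)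
      ≤ ∫⁻ y, ENNReal.ofReal (R ^ (-(d : ℝ))) * f (R⁻¹ • y) := lintegral_mono_ae key
    _ = ENNReal.ofReal (R ^ (-(d : ℝ))) * (ENNReal.ofReal (R ^ d) * ∫⁻ z, f z) := by
        rw [lintegral_const_mul _ (by fun_prop), scale hR hf]
    _ = ∫⁻ z, f z := by
        rw [← mul_assoc, ← ENNReal.ofReal_mul (by positivity), Real.rpow_neg hR.le,
          Real.rpow_natCast, inv_mul_cancel₀ (by positivity)]
        simp
    _ = _ := by rw [hfdef, lintegral_indicator measurableSet_ball]
    _ ≤ _ := le_rfl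

lemma rpow_comp {x y : ℝ} (hx : 0 < x) (hy : 0 < y) (h1 : x ≤ 4 * y) (h2 : y ≤ 4 * x) (p : ℝ) :
    x ^ p ≤ 4 ^ |p| * y ^ p := by
  rcases le_or_gt 0 p with hp | hp
  · rw [abs_of_nonneg hp, ← Real.mul_rpow (by norm_num) hy.le]
    exact Real.rpow_le_rpow hx.le h1 hp
  · rw [abs_of_neg hp, Real.rpow_neg (by norm_num), ← Real.inv_rpow (by norm_num),
      ← Real.mul_rpow (by norm_num) hy.le]
    exact Real.rpow_le_rpow_of_nonpos (by positivity) (by linarith) hp.le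

lemma J_comp {d : ℕ} {x y : EuclideanSpace ℝ (Fin d)} (h : ‖x‖ ≤ 2 * ‖y‖) : J x ≤ 4 * J y := by
  unfold J
  nlinarith [norm_nonneg x, norm_nonneg y]

lemma W_le {d : ℕ} (a b c : ℝ) (habc : a + b + c = (d : ℝ) / 2)
    (ξ η : EuclideanSpace ℝ (Fin d)) :
    ENNReal.ofReal (J (ξ - η) ^ (-a / 2) * J η ^ (-b / 2) * J ξ ^ (-c / 2)) ≤
      ENNReal.ofReal (4 ^ |-a / 2| + 4 ^ |-b / 2|) *
        (ker b ξ η + ker a ξ (ξ - η) + ker c η ξ) := by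
  have t1 : ‖ξ‖ ≤ ‖ξ - η‖ + ‖η‖ := by simpa using norm_add_le (ξ - η) η
  have t2 : ‖ξ - η‖ ≤ ‖ξ‖ + ‖η‖ := norm_sub_le _ _
  have t3 : ‖η‖ ≤ ‖ξ‖ + ‖ξ - η‖ := by simpa using norm_sub_le ξ (ξ - η)
  have p1 := J_pos ξ
  have p2 := J_pos η
  have p3 := J_pos (ξ - η)
  have comb : ∀ {x : ℝ}, 0 < x → ∀ p q r : ℝ, p + q = r → x ^ p * x ^ q = x ^ r := by
    intro x hx p q r h
    rw [← Real.rpow_add hx, h]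
  by_cases h1 : ‖η‖ ≤ ‖ξ - η‖ ∧ ‖η‖ ≤ ‖ξ‖
  · calc _ ≤ ENNReal.ofReal (4 ^ |-a / 2| + 4 ^ |-b / 2|) * ker b ξ η := by
          rw [ker, if_pos h1.2, ← ENNReal.ofReal_mul (by positivity)]
          apply ENNReal.ofReal_le_ofReal
          have h := rpow_comp p3 p1 (J_comp (by linarith)) (J_comp (by linarith)) (-a / 2)
          rw [← comb p1 (-a / 2) (-c / 2) (-((d : ℝ) / 2 - b) / 2) (by linarith)]
          calc _ ≤ (4 ^ |-a / 2| * J ξ ^ (-a / 2)) * J η ^ (-b / 2) * J ξ ^ (-c / 2) := by gcongr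
            _ = 4 ^ |-a / 2| * (J η ^ (-b / 2) * (J ξ ^ (-a / 2) * J ξ ^ (-c / 2))) := by ring
            _ ≤ _ := by
              gcongr
              have : (0:ℝ) ≤ 4 ^ |-b / 2| := by positivity
              linarith
      _ ≤ _ := by
          gcongr
          rw [add_assoc]; exact le_self_add
  by_cases h2 : ‖ξ - η‖ ≤ ‖η‖ ∧ ‖ξ - η‖ ≤ ‖ξ‖
  · calc _ ≤ ENNReal.ofReal (4 ^ |-a / 2| + 4 ^ |-b / 2|) * ker a ξ (ξ - η) := by
          rw [ker, if_pos h2.2, ← ENNReal.ofReal_mul (by positivity)]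
          apply ENNReal.ofReal_le_ofReal
          have h := rpow_comp p2 p1 (J_comp (by linarith)) (J_comp (by linarith)) (-b / 2)
          rw [← comb p1 (-b / 2) (-c / 2) (-((d : ℝ) / 2 - a) / 2) (by linarith)]
          calc _ ≤ J (ξ - η) ^ (-a / 2) * (4 ^ |-b / 2| * J ξ ^ (-b / 2)) * J ξ ^ (-c / 2) := by
                gcongr
            _ = 4 ^ |-b / 2| * (J (ξ - η) ^ (-a / 2) * (J ξ ^ (-b / 2) * J ξ ^ (-c / 2))) := by
                ring
            _ ≤ _ := by
              gcongr
              have : (0:ℝ) ≤ 4 ^ |-a / 2| := by positivity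
              linarith
      _ ≤ _ := by
          gcongr
          refine le_trans ?_ le_self_add
          exact le_add_self
  · have h3 : ‖ξ‖ ≤ ‖η‖ ∧ ‖ξ‖ ≤ ‖ξ - η‖ := by
      rw [not_and_or] at h1 h2
      push Not at h1 h2
      constructor <;> rcases h1 with h1 | h1 <;> rcases h2 with h2 | h2 <;> linarith
    calc _ ≤ ENNReal.ofReal (4 ^ |-a / 2| + 4 ^ |-b / 2|) * ker c η ξ := by
          rw [ker, if_pos h3.1, ← ENNReal.ofReal_mul (by positivity)]
          apply ENNReal.ofReal_le_ofReal
          have h := rpow_comp p3 p2 (J_comp (by linarith)) (J_comp (by linarith)) (-a / 2)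
          rw [← comb p2 (-a / 2) (-b / 2) (-((d : ℝ) / 2 - c) / 2) (by linarith)]
          calc _ ≤ (4 ^ |-a / 2| * J η ^ (-a / 2)) * J η ^ (-b / 2) * J ξ ^ (-c / 2) := by gcongr
            _ = 4 ^ |-a / 2| * (J ξ ^ (-c / 2) * (J η ^ (-a / 2) * J η ^ (-b / 2))) := by ring
            _ ≤ _ := by
              gcongr
              have : (0:ℝ) ≤ 4 ^ |-b / 2| := by positivity
              linarith
      _ ≤ _ := by
          gcongr
          exact le_add_self

lemma sum3 {d : ℕ} (M : ℝ≥0∞)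
    {u v w : EuclideanSpace ℝ (Fin d) → EuclideanSpace ℝ (Fin d) → ℝ≥0∞}
    (hu : Measurable (Function.uncurry u)) (hv : Measurable (Function.uncurry v))
    (hw : Measurable (Function.uncurry w)) :
    ∫⁻ x, ∫⁻ y, M * (u x y + v x y + w x y) =
      M * ((∫⁻ x, ∫⁻ y, u x y) + (∫⁻ x, ∫⁻ y, v x y) + (∫⁻ x, ∫⁻ y, w x y)) := by
  have hu' : Measurable fun x => ∫⁻ y, u x y := hu.lintegral_prod_right'
  have hv' : Measurable fun x => ∫⁻ y, v x y := hv.lintegral_prod_right'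
  have hw' : Measurable fun x => ∫⁻ y, w x y := hw.lintegral_prod_right'
  have h1 : ∀ x, ∫⁻ y, M * (u x y + v x y + w x y) =
      M * ((∫⁻ y, u x y) + (∫⁻ y, v x y) + (∫⁻ y, w x y)) := by
    intro x
    have a1 : Measurable (u x) := hu.comp measurable_prodMk_left
    have a2 : Measurable (v x) := hv.comp measurable_prodMk_left
    have a3 : Measurable (w x) := hw.comp measurable_prodMk_left
    rw [lintegral_const_mul _ (by fun_prop), lintegral_add_left (by fun_prop),
      lintegral_add_left (by fun_prop)]
  simp_rw [h1]
  rw [lintegral_const_mul _ (by fun_prop), lintegral_add_left (by fun_prop),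
    lintegral_add_left (by fun_prop)]

section pieces
variable {d : ℕ} {k : EuclideanSpace ℝ (Fin d) → EuclideanSpace ℝ (Fin d) → ℝ≥0∞}

lemma trilin2
    (hk : Measurable (fun p : EuclideanSpace ℝ (Fin d) × EuclideanSpace ℝ (Fin d) => k p.1 p.2))
    {K : ℝ≥0∞} (hK : ∀ x, ∫⁻ y, k x y ^ (2 : ℝ) ≤ K)
    {F G H : EuclideanSpace ℝ (Fin d) → ℝ≥0∞}
    (hF : Measurable F) (hG : Measurable G) (hH : Measurable H) :
    ∫⁻ ξ, ∫⁻ η, k ξ (ξ - η) * (F (ξ - η) * G η * H ξ) ≤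
      K ^ ((1 : ℝ) / 2) * (N2 F * N2 G * N2 H) := by
  have := trilin hk hK hG hF hH
  rw [mul_comm (N2 F)]
  refine le_trans (lintegral_mono fun ξ => le_of_eq ?_) this
  rw [← lintegral_sub_left_eq_self (fun η => k ξ η * (G (ξ - η) * F η * H ξ)) ξ]
  refine lintegral_congr fun η => ?_
  rw [sub_sub_cancel, mul_comm (F _)]

lemma trilin3
    (hk : Measurable (fun p : EuclideanSpace ℝ (Fin d) × EuclideanSpace ℝ (Fin d) => k p.1 p.2))
    {K : ℝ≥0∞} (hK : ∀ x, ∫⁻ y, k x y ^ (2 : ℝ) ≤ K)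
    {F G H : EuclideanSpace ℝ (Fin d) → ℝ≥0∞}
    (hF : Measurable F) (hG : Measurable G) (hH : Measurable H) :
    ∫⁻ ξ, ∫⁻ η, k η ξ * (F (ξ - η) * G η * H ξ) ≤
      K ^ ((1 : ℝ) / 2) * (N2 F * N2 G * N2 H) := by
  have mprod : Measurable
      (fun p : EuclideanSpace ℝ (Fin d) × EuclideanSpace ℝ (Fin d) =>
        F (p.1 - p.2) * G p.2 * H p.1) := by fun_prop
  have mc' : Measurable
      (fun p : EuclideanSpace ℝ (Fin d) × EuclideanSpace ℝ (Fin d) =>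
        k p.2 p.1) := hk.comp measurable_swap
  have := trilin hk hK (F := fun x => F (-x)) (by fun_prop) hH hG
  have e : N2 (fun x => F (-x)) = N2 F := by
    unfold N2
    rw [lintegral_neg_eq_self (fun x => F x ^ (2:ℝ))]
  rw [e] at this
  rw [mul_right_comm (N2 F)]
  refine le_trans (le_of_eq ?_) this
  rw [lintegral_lintegral_swap (mc'.mul mprod).aemeasurable]
  refine lintegral_congr fun ξ => lintegral_congr fun η => ?_
  rw [neg_sub, mul_right_comm (F _)]
end pieces

lemma combine {d : ℕ} {W k₁ k₂ k₃ : EuclideanSpace ℝ (Fin d) → EuclideanSpace ℝ (Fin d) → ℝ≥0∞}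
    {M K₁ K₂ K₃ : ℝ≥0∞}
    (hW : ∀ x y, W x y ≤ M * (k₁ x y + k₂ x (x - y) + k₃ y x))
    (h₁ : Measurable (fun p : EuclideanSpace ℝ (Fin d) × EuclideanSpace ℝ (Fin d) => k₁ p.1 p.2))
    (h₂ : Measurable (fun p : EuclideanSpace ℝ (Fin d) × EuclideanSpace ℝ (Fin d) => k₂ p.1 p.2))
    (h₃ : Measurable (fun p : EuclideanSpace ℝ (Fin d) × EuclideanSpace ℝ (Fin d) => k₃ p.1 p.2))
    (hK₁ : ∀ x, ∫⁻ y, k₁ x y ^ (2 : ℝ) ≤ K₁)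
    (hK₂ : ∀ x, ∫⁻ y, k₂ x y ^ (2 : ℝ) ≤ K₂)
    (hK₃ : ∀ x, ∫⁻ y, k₃ x y ^ (2 : ℝ) ≤ K₃)
    {F G H : EuclideanSpace ℝ (Fin d) → ℝ≥0∞}
    (hF : Measurable F) (hG : Measurable G) (hH : Measurable H) :
    ∫⁻ x, ∫⁻ y, W x y * (F (x - y) * G y * H x) ≤
      M * (K₁ ^ ((1 : ℝ) / 2) + K₂ ^ ((1 : ℝ) / 2) + K₃ ^ ((1 : ℝ) / 2)) *
        (N2 F * N2 G * N2 H) := by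
  have mprod : Measurable
      (fun p : EuclideanSpace ℝ (Fin d) × EuclideanSpace ℝ (Fin d) =>
        F (p.1 - p.2) * G p.2 * H p.1) := by fun_prop
  have q₂ : Measurable (fun p : EuclideanSpace ℝ (Fin d) × EuclideanSpace ℝ (Fin d) =>
      k₂ p.1 (p.1 - p.2)) :=
    h₂.comp (measurable_fst.prodMk (measurable_fst.sub measurable_snd))
  have q₃ : Measurable (fun p : EuclideanSpace ℝ (Fin d) × EuclideanSpace ℝ (Fin d) =>
      k₃ p.2 p.1) := h₃.comp measurable_swap
  have m1 : Measurable (Function.uncurry fun ξ η => k₁ ξ η * (F (ξ - η) * G η * H ξ)) :=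
    h₁.mul mprod
  have m2 : Measurable (Function.uncurry fun ξ η => k₂ ξ (ξ - η) * (F (ξ - η) * G η * H ξ)) :=
    q₂.mul mprod
  have m3 : Measurable (Function.uncurry fun ξ η => k₃ η ξ * (F (ξ - η) * G η * H ξ)) :=
    q₃.mul mprod
  have T1 := trilin h₁ hK₁ hF hG hH
  have T2 := trilin2 h₂ hK₂ hF hG hH
  have T3 := trilin3 h₃ hK₃ hF hG hH
  calc ∫⁻ x, ∫⁻ y, W x y * (F (x - y) * G y * H x)
      ≤ ∫⁻ x, ∫⁻ y, M * (k₁ x y * (F (x - y) * G y * H x) +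
          k₂ x (x - y) * (F (x - y) * G y * H x) + k₃ y x * (F (x - y) * G y * H x)) := by
        refine lintegral_mono fun ξ => lintegral_mono fun η => ?_
        calc W ξ η * (F (ξ - η) * G η * H ξ)
            ≤ (M * (k₁ ξ η + k₂ ξ (ξ - η) + k₃ η ξ)) * (F (ξ - η) * G η * H ξ) := by
              gcongr
              exact hW ξ η
          _ = _ := by ring
    _ = _ := sum3 M m1 m2 m3
    _ ≤ M * (K₁ ^ ((1 : ℝ) / 2) * (N2 F * N2 G * N2 H) +
          K₂ ^ ((1 : ℝ) / 2) * (N2 F * N2 G * N2 H) +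
          K₃ ^ ((1 : ℝ) / 2) * (N2 F * N2 G * N2 H)) := by gcongr
    _ = _ := by ring

lemma main_trilin {d : ℕ} (hd : 1 ≤ d) (a b c : ℝ) (habc : a + b + c = (d : ℝ) / 2)
    (ha : a < (d : ℝ) / 2) (hb : b < (d : ℝ) / 2) (hc : c < (d : ℝ) / 2) :
    ∃ C : ℝ≥0∞, C < ∞ ∧ ∀ F G H : EuclideanSpace ℝ (Fin d) → ℝ≥0∞,
      Measurable F → Measurable G → Measurable H →
      ∫⁻ ξ, ∫⁻ η, ENNReal.ofReal (J (ξ - η) ^ (-a / 2) * J η ^ (-b / 2) * J ξ ^ (-c / 2)) *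
        (F (ξ - η) * G η * H ξ) ≤ C * (N2 F * N2 G * N2 H) := by
  obtain ⟨Ka, hKa, ka⟩ := ker_int hd a ha
  obtain ⟨Kb, hKb, kb⟩ := ker_int hd b hb
  obtain ⟨Kc, hKc, kc⟩ := ker_int hd c hc
  refine ⟨ENNReal.ofReal (4 ^ |-a / 2| + 4 ^ |-b / 2|) *
    (Kb ^ ((1 : ℝ) / 2) + Ka ^ ((1 : ℝ) / 2) + Kc ^ ((1 : ℝ) / 2)), ?_, ?_⟩
  · refine ENNReal.mul_lt_top ENNReal.ofReal_lt_top ?_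
    simp only [ENNReal.add_lt_top]
    exact ⟨⟨ENNReal.rpow_lt_top_of_nonneg (by norm_num) hKb.ne,
      ENNReal.rpow_lt_top_of_nonneg (by norm_num) hKa.ne⟩,
      ENNReal.rpow_lt_top_of_nonneg (by norm_num) hKc.ne⟩
  intro F G H hF hG hH
  exact combine (W_le a b c habc) (ker_meas b) (ker_meas a) (ker_meas c) kb ka kc hF hG hH

end SobProd
namespace SobProd

lemma fourier_prod_le {d : ℕ} (f g : SchwartzMap (EuclideanSpace ℝ (Fin d)) ℂ)
    (ξ : EuclideanSpace ℝ (Fin d)) :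
    ‖𝓕 (fun x => f x * g x) ξ‖ₑ ≤ ∫⁻ η, ‖𝓕 (⇑f) (ξ - η)‖ₑ * ‖𝓕 (⇑g) η‖ₑ := by
  set B := ContinuousLinearMap.mul ℂ ℂ
  have h1 : SchwartzMap.convolution B (𝓕⁻ f) (𝓕⁻ g) = 𝓕⁻ (SchwartzMap.pairing B f g) := by
    simp [SchwartzMap.convolution]
  have h2 : 𝓕 (fun x => f x * g x) ξ = (𝓕⁻ (SchwartzMap.pairing B f g)) (-ξ) := by
    rw [SchwartzMap.fourierInv_coe, Real.fourierInv_eq_fourier_neg, neg_neg]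
    rfl
  rw [h2, ← h1, SchwartzMap.convolution_apply, ← convolution_flip]
  unfold convolution
  refine (enorm_integral_le_lintegral_enorm _).trans (le_of_eq ?_)
  rw [← lintegral_neg_eq_self]
  congr 1; ext η
  rw [SchwartzMap.fourierInv_coe, SchwartzMap.fourierInv_coe, Real.fourierInv_eq_fourier_neg,
    Real.fourierInv_eq_fourier_neg]
  simp [B, add_comm, sub_eq_add_neg, mul_comm]

lemma wsq {d : ℕ} (s : ℝ) (h : EuclideanSpace ℝ (Fin d) → ℂ) :
    N2 (fun ξ => ENNReal.ofReal (J ξ ^ (s / 2)) * ‖h ξ‖ₑ) =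
    (∫⁻ ξ : EuclideanSpace ℝ (Fin d),
      ENNReal.ofReal ((1 + ‖ξ‖ ^ 2) ^ s * ‖h ξ‖ ^ 2)) ^ ((1 : ℝ) / 2) := by
  unfold N2
  congr 2; ext ξ
  have := J_pos ξ
  simp only
  rw [← ofReal_norm, ← ENNReal.ofReal_mul (by positivity),
    ENNReal.ofReal_rpow_of_nonneg (by positivity) (by norm_num),
    Real.mul_rpow (by positivity) (by positivity), ← Real.rpow_mul this.le]
  congr 2
  · rw [J]; congr 1; ring
  · norm_num

lemma N2_fin {d : ℕ} (s : ℝ) (h : SchwartzMap (EuclideanSpace ℝ (Fin d)) ℂ) :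
    N2 (fun ξ => ENNReal.ofReal (J ξ ^ (s / 2)) * ‖h ξ‖ₑ) < ∞ := by
  have ht := Function.hasTemperateGrowth_one_add_norm_sq_rpow
    (EuclideanSpace ℝ (Fin d)) (s / 2)
  have hm := (SchwartzMap.smulLeftCLM ℂ
    (fun x : EuclideanSpace ℝ (Fin d) => (1 + ‖x‖ ^ 2) ^ (s / 2)) h).memLp 2 volume
  have := lintegral_rpow_enorm_lt_top_of_eLpNorm_lt_top (by norm_num) (by norm_num)
    hm.eLpNorm_lt_top
  refine ENNReal.rpow_lt_top_of_nonneg (by norm_num) (ne_of_lt ?_)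
  convert this using 1
  congr 1; ext ξ
  rw [SchwartzMap.smulLeftCLM_apply_apply ht, enorm_smul, ENNReal.toReal_ofNat]
  have := J_pos ξ
  rw [Real.enorm_of_nonneg (by positivity)]
  rfl

lemma cancel {d : ℕ} (s : ℝ) (x : EuclideanSpace ℝ (Fin d)) :
    ENNReal.ofReal (J x ^ (-s / 2)) * ENNReal.ofReal (J x ^ (s / 2)) = 1 := by
  have := J_pos x
  rw [← ENNReal.ofReal_mul (by positivity), ← Real.rpow_add this]
  simp [neg_div]

end SobProd

theorem sobolev_product_estimate
    (d : ℕ) (hd : 1 ≤ d) (s₁ s₂ : ℝ)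
    (hs₁ : 0 < s₁ ∧ s₁ < (d : ℝ) / 2) (hs₂ : 0 < s₂ ∧ s₂ < (d : ℝ) / 2) :
    ∃ C : ℝ, 0 < C ∧
      ∀ f g : SchwartzMap (EuclideanSpace ℝ (Fin d)) ℂ,
        (∫⁻ ξ : EuclideanSpace ℝ (Fin d),
            ENNReal.ofReal ((1 + ‖ξ‖ ^ 2) ^ (s₁ + s₂ - (d : ℝ) / 2) *
              ‖𝓕 (fun x => f x * g x) ξ‖ ^ 2)) ^ ((1 : ℝ) / 2) ≤
          ENNReal.ofReal C *
            (∫⁻ ξ : EuclideanSpace ℝ (Fin d),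
              ENNReal.ofReal ((1 + ‖ξ‖ ^ 2) ^ s₁ * ‖𝓕 (⇑f) ξ‖ ^ 2)) ^ ((1 : ℝ) / 2) *
            (∫⁻ ξ : EuclideanSpace ℝ (Fin d),
              ENNReal.ofReal ((1 + ‖ξ‖ ^ 2) ^ s₂ * ‖𝓕 (⇑g) ξ‖ ^ 2)) ^ ((1 : ℝ) / 2) := by
  obtain ⟨C, hC, hT⟩ := SobProd.main_trilin hd s₁ s₂ ((d : ℝ) / 2 - s₁ - s₂) (by ring)
    hs₁.2 hs₂.2 (by linarith [hs₁.1, hs₂.1])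
  refine ⟨C.toReal + 1, by positivity, fun f g => ?_⟩
  have hCle : C ≤ ENNReal.ofReal (C.toReal + 1) := by
    rw [← ENNReal.ofReal_toReal hC.ne]
    apply ENNReal.ofReal_le_ofReal
    simp
  rw [← SobProd.wsq, ← SobProd.wsq, ← SobProd.wsq]
  set s := s₁ + s₂ - (d : ℝ) / 2 with hs
  set h : EuclideanSpace ℝ (Fin d) → ℂ := 𝓕 (fun x => f x * g x) with hh
  let hS : SchwartzMap (EuclideanSpace ℝ (Fin d)) ℂ :=
    𝓕 (SchwartzMap.pairing (ContinuousLinearMap.mul ℂ ℂ) f g)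
  have hhS : h = ⇑hS := rfl
  set F : EuclideanSpace ℝ (Fin d) → ℝ≥0∞ :=
    fun ξ => ENNReal.ofReal (SobProd.J ξ ^ (s₁ / 2)) * ‖𝓕 (⇑f) ξ‖ₑ with hF
  set G : EuclideanSpace ℝ (Fin d) → ℝ≥0∞ :=
    fun ξ => ENNReal.ofReal (SobProd.J ξ ^ (s₂ / 2)) * ‖𝓕 (⇑g) ξ‖ₑ with hG
  set H : EuclideanSpace ℝ (Fin d) → ℝ≥0∞ :=
    fun ξ => ENNReal.ofReal (SobProd.J ξ ^ (s / 2)) * ‖h ξ‖ₑ with hH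
  have mJ := SobProd.J_meas (d := d)
  have cf : Continuous (𝓕 (⇑f)) := (𝓕 f).continuous
  have cg : Continuous (𝓕 (⇑g)) := (𝓕 g).continuous
  have ch : Continuous h := hS.continuous
  have mF : Measurable F := by
    have := cf.measurable
    fun_prop
  have mG : Measurable G := by
    have := cg.measurable
    fun_prop
  have mH : Measurable H := by
    have := ch.measurable
    fun_prop
  have fin : SobProd.N2 H < ∞ := SobProd.N2_fin s hS
  have key := hT F G H mF mG mH
  have low : SobProd.N2 H ^ (2 : ℝ) ≤ C * (SobProd.N2 F * SobProd.N2 G * SobProd.N2 H) := by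
    refine le_trans ?_ key
    rw [SobProd.N2_rpow]
    refine lintegral_mono fun ξ => ?_
    have e : ∀ η, ENNReal.ofReal (SobProd.J (ξ - η) ^ (-s₁ / 2) * SobProd.J η ^ (-s₂ / 2) *
        SobProd.J ξ ^ (-((d : ℝ) / 2 - s₁ - s₂) / 2)) * (F (ξ - η) * G η * H ξ) =
        (ENNReal.ofReal (SobProd.J ξ ^ (s / 2)) * H ξ) *
          (‖𝓕 (⇑f) (ξ - η)‖ₑ * ‖𝓕 (⇑g) η‖ₑ) := by
      intro η
      have p1 := SobProd.J_pos ξ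
      have p2 := SobProd.J_pos η
      have p3 := SobProd.J_pos (ξ - η)
      have c1 := SobProd.cancel s₁ (ξ - η)
      have c2 := SobProd.cancel s₂ η
      have e3 : -((d : ℝ) / 2 - s₁ - s₂) / 2 = s / 2 := by rw [hs]; ring
      rw [e3, ENNReal.ofReal_mul (by positivity), ENNReal.ofReal_mul (by positivity)]
      simp only [hF, hG]
      generalize ENNReal.ofReal (SobProd.J (ξ - η) ^ (-s₁ / 2)) = A at *
      generalize ENNReal.ofReal (SobProd.J (ξ - η) ^ (s₁ / 2)) = A' at *
      generalize ENNReal.ofReal (SobProd.J η ^ (-s₂ / 2)) = B at *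
      generalize ENNReal.ofReal (SobProd.J η ^ (s₂ / 2)) = B' at *
      calc _ = (A * A') * (B * B') * (ENNReal.ofReal (SobProd.J ξ ^ (s / 2)) * H ξ *
          (‖𝓕 (⇑f) (ξ - η)‖ₑ * ‖𝓕 (⇑g) η‖ₑ)) := by ring
        _ = _ := by rw [c1, c2, one_mul, one_mul]
    simp_rw [e]
    have mm : Measurable (fun η => ‖𝓕 (⇑f) (ξ - η)‖ₑ * ‖𝓕 (⇑g) η‖ₑ) := by
      have := cf.measurable
      have := cg.measurable
      fun_prop
    rw [lintegral_const_mul _ mm]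
    calc H ξ ^ (2 : ℝ) = (ENNReal.ofReal (SobProd.J ξ ^ (s / 2)) * H ξ) * ‖h ξ‖ₑ := by
          rw [ENNReal.rpow_two, sq]
          nth_rewrite 1 [hH]
          ring
      _ ≤ _ := by
          gcongr
          exact SobProd.fourier_prod_le f g ξ
  rcases eq_or_ne (SobProd.N2 H) 0 with h0 | h0
  · rw [h0]; exact zero_le
  have : SobProd.N2 H ≤ C * (SobProd.N2 F * SobProd.N2 G) := by
    rw [ENNReal.rpow_two, sq, ← mul_assoc, ← mul_assoc] at low
    rw [← mul_assoc]
    exact (ENNReal.mul_le_mul_iff_left h0 fin.ne).1 low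
  refine this.trans ?_
  rw [← mul_assoc]
  gcongr
end

section
/- Continuity bootstrap lemma (abstracting Step 3 of the proof of Theorem theo3): Let C₁, C₂ > 0 and ε > 0 satisfy 64·C₁²·ε² ≤ 1 and 16·C₂·ε² ≤ 1. Let E : [0,∞) → ℝ be continuous and nonnegative with E(0) ≤ ε², and suppose that for every t ≥ 0, E(t) ≤ E(0) + C₁·E(t)^{3/2} + C₂·E(t)². Then E(t) ≤ 2ε² for every t ≥ 0. -/
open Real

/-- **Continuity bootstrap lemma** (abstracting Step 3 of the proof of Theorem `theo3`).
Let `C₁, C₂ > 0` and `ε > 0` with `64 C₁² ε² ≤ 1` and `16 C₂ ε² ≤ 1`. If `E : [0,∞) → ℝ` is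
continuous, nonnegative, `E 0 ≤ ε²`, and `E t ≤ E 0 + C₁ E t^{3/2} + C₂ E t²` for all `t ≥ 0`,
then `E t ≤ 2ε²` for all `t ≥ 0`. Here `E t^{3/2}` is `E t * √(E t)`. -/
theorem continuity_bootstrap
    (C₁ C₂ ε : ℝ) (hC₁ : 0 < C₁) (hC₂ : 0 < C₂) (hε : 0 < ε)
    (h₁ : 64 * C₁ ^ 2 * ε ^ 2 ≤ 1) (h₂ : 16 * C₂ * ε ^ 2 ≤ 1)
    (E : ℝ → ℝ)
    (hcont : ContinuousOn E (Set.Ici (0 : ℝ)))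
    (hnonneg : ∀ t, 0 ≤ t → 0 ≤ E t)
    (hE0 : E 0 ≤ ε ^ 2)
    (hineq : ∀ t, 0 ≤ t → E t ≤ E 0 + C₁ * (E t * Real.sqrt (E t)) + C₂ * E t ^ 2) :
    ∀ t, 0 ≤ t → E t ≤ 2 * ε ^ 2 := by
  have hce : C₁ * ε ≤ 1 / 8 := by
    have hp : 0 < C₁ * ε := mul_pos hC₁ hε
    nlinarith
  have key : ∀ s, 0 ≤ s → E s ≤ 4 * ε ^ 2 → E s ≤ 2 * ε ^ 2 := by
    intro s hs h4
    have h0 := hnonneg s hs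
    have hsq : Real.sqrt (E s) ≤ 2 * ε := by
      apply Real.sqrt_le_iff.mpr
      constructor
      · positivity
      · nlinarith
    have a1 : C₁ * Real.sqrt (E s) ≤ 1 / 4 := by
      have := mul_le_mul_of_nonneg_left hsq hC₁.le
      linarith
    have a2 : C₂ * E s ≤ 1 / 4 := by
      have := mul_le_mul_of_nonneg_left h4 hC₂.le
      linarith
    have b1 := mul_le_mul_of_nonneg_right a1 h0
    have b2 := mul_le_mul_of_nonneg_right a2 h0
    have h := hineq s hs
    nlinarith
  intro t ht
  by_cases h4 : E t ≤ 4 * ε ^ 2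
  · exact key t ht h4
  · have hpos : 0 < ε ^ 2 := by positivity
    have hivt := intermediate_value_Icc ht (hcont.mono Set.Icc_subset_Ici_self)
    obtain ⟨s, hs, hEs⟩ := hivt
      (show 4 * ε ^ 2 ∈ Set.Icc (E 0) (E t) from ⟨by linarith, by linarith⟩)
    have := key s hs.1 hEs.le
    linarith
end

section
/- L^p boundedness of the exponential-kernel maximal operator (Step 2 of the proof of Proposition pro-F_heat): Let c > 0, T ∈ (0,∞], and r ∈ (1,∞). There is a constant C = C(c,r) > 0 such that for every measurable g : ℝ → ℝ, defining Mg(τ) := sup_{ρ>0} ∫₀^T ρ·𝟙_{t≥τ}·exp(−c·(t−τ)·ρ)·|g(t)| dt for τ ∈ (0,T) and Mg(τ) := 0 for τ ∉ (0,T), one has ( ∫₀^T (Mg(τ))^{r} dτ )^{1/r} ≤ C·( ∫₀^T |g(t)|^{r} dt )^{1/r}, understood as an inequality in [0,∞]. -/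
open MeasureTheory Real
open scoped ENNReal NNReal

noncomputable section

/-- The time interval `(0,T)` for `T ∈ (0,∞]`, as a subset of `ℝ`. -/
def timeInterval (T : ℝ≥0∞) : Set ℝ := {t : ℝ | 0 < t ∧ ENNReal.ofReal t < T}

open Classical in
/-- The exponential-kernel maximal operator
`Mg(τ) = sup_{ρ>0} ∫₀^T ρ 𝟙_{t≥τ} e^{−c(t−τ)ρ} |g(t)| dt` for `τ ∈ (0,T)`, and `0` otherwise. -/
def expKernelMax (c : ℝ) (T : ℝ≥0∞) (g : ℝ → ℝ) (τ : ℝ) : ℝ≥0∞ :=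
  if τ ∈ timeInterval T then
    ⨆ (ρ : ℝ) (_ : 0 < ρ), ∫⁻ t in timeInterval T,
      ENNReal.ofReal (if τ ≤ t then ρ * Real.exp (-(c * (t - τ) * ρ)) * |g t| else 0)
  else 0

/-- averaged maximal function over rational radii -/
noncomputable def avgMax (f : ℝ → ℝ≥0∞) (x : ℝ) : ℝ≥0∞ :=
  ⨆ q : {q : ℚ // 0 < q}, (ENNReal.ofReal (q.1 : ℝ))⁻¹ * ∫⁻ t in Metric.ball x (q.1 : ℝ), f t

lemma avgMax_measurable (f : ℝ → ℝ≥0∞) (hf : Measurable f) : Measurable (avgMax f) := by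
  unfold avgMax
  refine Measurable.iSup fun q => Measurable.const_mul ?_ _
  have : (fun x : ℝ => ∫⁻ t in Metric.ball x (q.1 : ℝ), f t) =
      fun x : ℝ => ∫⁻ t, ({p : ℝ × ℝ | dist p.2 p.1 < (q.1 : ℝ)}.indicator (fun p => f p.2)) (x, t) := by
    funext x
    rw [← lintegral_indicator Metric.isOpen_ball.measurableSet]
    rfl
  rw [this]
  refine Measurable.lintegral_prod_right' (Measurable.indicator (by fun_prop) ?_)
  exact measurableSet_lt (by fun_prop) (by fun_prop)

lemma ball_le_avgMax (f : ℝ → ℝ≥0∞) (x h : ℝ) (hh : 0 < h) :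
    ∫⁻ t in Metric.ball x h, f t ≤ ENNReal.ofReal (2 * h) * avgMax f x := by
  obtain ⟨q, hq1, hq2⟩ := exists_rat_btwn (show h < 2 * h by linarith)
  have hq0 : (0:ℝ) < q := hh.trans hq1
  have hq0' : (0:ℚ) < q := by exact_mod_cast hq0
  have h1 : (ENNReal.ofReal (q : ℝ))⁻¹ * ∫⁻ t in Metric.ball x (q : ℝ), f t ≤ avgMax f x :=
    le_iSup (fun q : {q : ℚ // 0 < q} =>
      (ENNReal.ofReal (q.1 : ℝ))⁻¹ * ∫⁻ t in Metric.ball x (q.1 : ℝ), f t) ⟨q, hq0'⟩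
  calc ∫⁻ t in Metric.ball x h, f t ≤ ∫⁻ t in Metric.ball x (q : ℝ), f t :=
        lintegral_mono_set (Metric.ball_subset_ball hq1.le)
    _ = ENNReal.ofReal q * ((ENNReal.ofReal (q : ℝ))⁻¹ * ∫⁻ t in Metric.ball x (q : ℝ), f t) := by
        rw [← mul_assoc, ENNReal.mul_inv_cancel, one_mul]
        · simpa using hq0
        · exact ENNReal.ofReal_ne_top
    _ ≤ ENNReal.ofReal (2 * h) * avgMax f x := by
        gcongr

lemma avgMax_weak (f : ℝ → ℝ≥0∞) (l : ℝ≥0∞) (hl : 0 < l) (hlt : l ≠ ⊤) :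
    l * volume {x | l < avgMax f x} ≤ 10 * ∫⁻ t, f t := by
  by_cases hI : ∫⁻ t, f t = ⊤
  · rw [hI]; simp
  have hex : ∀ x : ℝ, ∃ q : ℝ, x ∈ {x | l < avgMax f x} →
      0 < q ∧ l * ENNReal.ofReal q ≤ ∫⁻ t in Metric.ball x q, f t := by
    intro x
    by_cases hx : l < avgMax f x
    · obtain ⟨q, hq⟩ := lt_iSup_iff.1 hx
      have hq0 : (0:ℝ) < (q.1 : ℝ) := by exact_mod_cast q.2
      refine ⟨q.1, fun _ => ⟨hq0, ?_⟩⟩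
      rw [mul_comm] at hq
      rw [← div_eq_mul_inv] at hq
      exact (ENNReal.le_div_iff_mul_le (Or.inl (by simpa using hq0))
        (Or.inl ENNReal.ofReal_ne_top)).1 hq.le
    · exact ⟨0, fun h => absurd h hx⟩
  choose q hq using hex
  set E := {x | l < avgMax f x} with hE
  have hR : ∀ a ∈ E, q a ≤ ((∫⁻ t, f t) / l).toReal := by
    intro a ha
    have h1 := (hq a ha).2.trans (setLIntegral_le_lintegral _ _)
    rw [mul_comm] at h1
    have h2 := (ENNReal.le_div_iff_mul_le (Or.inl hl.ne') (Or.inl hlt)).2 h1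
    exact (ENNReal.ofReal_le_iff_le_toReal (ENNReal.div_ne_top hI hl.ne')).1 h2
  obtain ⟨u, huE, hud, huc⟩ := Vitali.exists_disjoint_subfamily_covering_enlargement_closedBall
    E (fun x : ℝ => x) q _ hR 5 (by norm_num)
  have hucount : u.Countable := by
    refine hud.countable_of_nonempty_interior ?_
    intro a ha
    exact ⟨a, Metric.ball_subset_interior_closedBall (Metric.mem_ball_self (hq a (huE ha)).1)⟩
  have hcov : E ⊆ ⋃ b ∈ u, Metric.closedBall b (5 * q b) := by
    intro a ha
    obtain ⟨b, hb, hab⟩ := huc a ha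
    exact Set.mem_biUnion hb (hab (Metric.mem_closedBall_self (hq a ha).1.le))
  have := hucount.to_subtype
  calc l * volume E ≤ l * ∑' b : u, volume (Metric.closedBall (b:ℝ) (5 * q b)) := by
        gcongr
        exact (measure_mono hcov).trans (measure_biUnion_le _ hucount _)
    _ = ∑' b : u, 10 * (l * ENNReal.ofReal (q b)) := by
        rw [← ENNReal.tsum_mul_left]
        congr 1; funext b
        rw [Real.volume_closedBall, show 2 * (5 * q b) = 10 * q b by ring,
          ENNReal.ofReal_mul (by norm_num)]
        simp only [ENNReal.ofReal_ofNat]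
        ring
    _ ≤ ∑' b : u, 10 * ∫⁻ t in Metric.closedBall (b:ℝ) (q b), f t := by
        gcongr with b
        exact ((hq b (huE b.2)).2).trans (lintegral_mono_set Metric.ball_subset_closedBall)
    _ = 10 * ∫⁻ t in ⋃ b ∈ u, Metric.closedBall (b:ℝ) (q b), f t := by
        rw [ENNReal.tsum_mul_left, lintegral_biUnion hucount
          (fun _ _ => Metric.isClosed_closedBall.measurableSet) hud]
    _ ≤ 10 * ∫⁻ t, f t := by
        gcongr
        exact Measure.restrict_le_self

lemma avgMax_trunc (f : ℝ → ℝ≥0∞) (l : ℝ≥0∞) (hl : 0 < l) (hlt : l ≠ ⊤) :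
    l * volume {x | 3 * l < avgMax f x} ≤ 10 * ∫⁻ t, {t | l < f t}.indicator f t := by
  refine le_trans ?_ (avgMax_weak _ l hl hlt)
  refine mul_le_mul_right (measure_mono ?_) l
  intro x hx
  have key : avgMax f x ≤ avgMax ({t | l < f t}.indicator f) x + 2 * l := by
    refine iSup_le fun q => ?_
    have hq0 : (0:ℝ) < (q.1 : ℝ) := by exact_mod_cast q.2
    calc (ENNReal.ofReal (q.1 : ℝ))⁻¹ * ∫⁻ t in Metric.ball x (q.1 : ℝ), f t
        ≤ (ENNReal.ofReal (q.1 : ℝ))⁻¹ * ∫⁻ t in Metric.ball x (q.1 : ℝ),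
            ({t | l < f t}.indicator f t + l) := by
          gcongr with t
          by_cases ht : l < f t
          · simp [Set.indicator, ht]
          · simp [Set.indicator, ht, not_lt.1 ht]
      _ = (ENNReal.ofReal (q.1 : ℝ))⁻¹ * (∫⁻ t in Metric.ball x (q.1 : ℝ),
            {t | l < f t}.indicator f t) + (ENNReal.ofReal (q.1 : ℝ))⁻¹ *
              (l * (2 * ENNReal.ofReal (q.1 : ℝ))) := by
          rw [lintegral_add_right _ measurable_const, mul_add, setLIntegral_const,
            Real.volume_ball, ENNReal.ofReal_mul (by norm_num)]
          simp
      _ = (ENNReal.ofReal (q.1 : ℝ))⁻¹ * (∫⁻ t in Metric.ball x (q.1 : ℝ),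
            {t | l < f t}.indicator f t) + 2 * l := by
          congr 1
          rw [show l * (2 * ENNReal.ofReal (q.1 : ℝ)) = ENNReal.ofReal (q.1 : ℝ) * (2 * l) by ring,
            ← mul_assoc, ENNReal.inv_mul_cancel, one_mul]
          · simpa using hq0
          · exact ENNReal.ofReal_ne_top
      _ ≤ _ := by
          gcongr
          exact le_iSup (fun q : {q : ℚ // 0 < q} => (ENNReal.ofReal (q.1 : ℝ))⁻¹ *
            ∫⁻ t in Metric.ball x (q.1 : ℝ), {t | l < f t}.indicator f t) q
  have h3 : l + 2 * l < avgMax ({t | l < f t}.indicator f) x + 2 * l := by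
    refine lt_of_lt_of_le ?_ key
    have : l + 2 * l = 3 * l := by ring
    rw [this]; exact hx
  exact lt_of_add_lt_add_right h3

lemma lint_pow (s a : ℝ) (hs : -1 < s) (ha : 0 ≤ a) :
    ∫⁻ l in Set.Ioc 0 a, ENNReal.ofReal (l ^ s) = ENNReal.ofReal (a ^ (s + 1) / (s + 1)) := by
  have hi := (intervalIntegral.intervalIntegrable_rpow' (a := 0) (b := a) hs)
  rw [intervalIntegrable_iff_integrableOn_Ioc_of_le ha] at hi
  rw [← ofReal_integral_eq_lintegral_ofReal hi, ← intervalIntegral.integral_of_le ha,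
    integral_rpow (Or.inl hs), Real.zero_rpow (by linarith), sub_zero]
  exact (ae_restrict_iff' measurableSet_Ioc).2 (ae_of_all _ fun l hl => Real.rpow_nonneg hl.1.le _)

lemma layer_low (r : ℝ) (hr : 1 < r) (b : ℝ≥0∞) :
    b ^ r ≤ ENNReal.ofReal r * ∫⁻ l in Set.Ioi (0:ℝ),
      {l : ℝ | ENNReal.ofReal l < b}.indicator (fun l => ENNReal.ofReal (l ^ (r - 1))) l := by
  have hr0 : 0 < r := by linarith
  rw [← ENNReal.le_rpow_inv_iff hr0]
  refine ENNReal.le_of_forall_nnreal_lt fun a ha => ?_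
  rw [ENNReal.le_rpow_inv_iff hr0]
  calc (a : ℝ≥0∞) ^ r = ENNReal.ofReal r * ∫⁻ l in Set.Ioc (0:ℝ) a, ENNReal.ofReal (l ^ (r - 1)) := by
        rw [lint_pow _ _ (by linarith) a.coe_nonneg, ← ENNReal.ofReal_mul hr0.le, sub_add_cancel,
          mul_div_cancel₀ _ hr0.ne', ← ENNReal.ofReal_rpow_of_nonneg a.coe_nonneg hr0.le,
          ENNReal.ofReal_coe_nnreal]
    _ = ENNReal.ofReal r * ∫⁻ l in Set.Ioc (0:ℝ) a,
      {l : ℝ | ENNReal.ofReal l < b}.indicator (fun l => ENNReal.ofReal (l ^ (r - 1))) l := by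
        congr 1
        refine setLIntegral_congr_fun measurableSet_Ioc fun l hl => ?_
        rw [Set.indicator_of_mem]
        refine lt_of_le_of_lt ?_ ha
        rw [← ENNReal.ofReal_coe_nnreal]
        exact ENNReal.ofReal_le_ofReal hl.2
    _ ≤ _ := by
        gcongr
        exact Set.Ioc_subset_Ioi_self

lemma layer_up (r : ℝ) (hr : 1 < r) (b : ℝ≥0∞) (hb : b ≠ ⊤) :
    b * ∫⁻ l in Set.Ioi (0:ℝ),
      {l : ℝ | ENNReal.ofReal l < b}.indicator (fun l => ENNReal.ofReal (l ^ (r - 2))) l ≤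
      ENNReal.ofReal (1 / (r - 1)) * b ^ r := by
  have h1 : ∫⁻ l in Set.Ioi (0:ℝ),
      {l : ℝ | ENNReal.ofReal l < b}.indicator (fun l => ENNReal.ofReal (l ^ (r - 2))) l ≤
      ∫⁻ l in Set.Ioc 0 b.toReal, ENNReal.ofReal (l ^ (r - 2)) := by
    rw [← lintegral_indicator measurableSet_Ioi, ← lintegral_indicator measurableSet_Ioc]
    refine lintegral_mono fun l => ?_
    by_cases h0 : l ∈ Set.Ioi (0:ℝ)
    · rw [Set.indicator_of_mem h0]
      by_cases h : ENNReal.ofReal l < b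
      · rw [Set.indicator_of_mem (show l ∈ {l : ℝ | ENNReal.ofReal l < b} from h),
          Set.indicator_of_mem]
        exact ⟨h0, (ENNReal.ofReal_le_iff_le_toReal hb).1 h.le⟩
      · rw [Set.indicator_of_notMem (show l ∉ {l : ℝ | ENNReal.ofReal l < b} from h)]
        exact zero_le
    · rw [Set.indicator_of_notMem h0]; exact zero_le
  refine (mul_le_mul_right h1 b).trans ?_
  rw [lint_pow _ _ (by linarith) ENNReal.toReal_nonneg]
  lift b to ℝ≥0 using hb
  have hr1 : 0 < r - 1 := by linarith
  rw [ENNReal.coe_toReal, ← ENNReal.ofReal_coe_nnreal, ENNReal.ofReal_rpow_of_nonneg b.coe_nonneg (by linarith),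
    ← ENNReal.ofReal_mul b.coe_nonneg, ← ENNReal.ofReal_mul (by positivity)]
  apply ENNReal.ofReal_le_ofReal
  rw [show r - 2 + 1 = r - 1 by ring]
  have : (b:ℝ) * (b:ℝ) ^ (r - 1) = (b:ℝ) ^ r := by
    rcases eq_or_lt_of_le b.2 with h | h
    · have h' : (b:ℝ) = 0 := h.symm
      rw [h', Real.zero_rpow (by linarith : r ≠ 0), zero_mul]
    · have h' : (0:ℝ) < b := h
      rw [Real.rpow_sub_one h'.ne']; field_simp
  apply le_of_eq
  rw [← this]; ring

lemma avgMax_strong (r : ℝ) (hr : 1 < r) (f : ℝ → ℝ≥0∞) (hf : Measurable f)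
    (hft : ∀ t, f t ≠ ⊤) :
    ∫⁻ x, (avgMax f x / 3) ^ r ≤
      ENNReal.ofReal r * (10 * (ENNReal.ofReal (1 / (r - 1)) * ∫⁻ t, f t ^ r)) := by
  have hm := avgMax_measurable f hf
  have hm3 : Measurable fun x => avgMax f x / 3 := hm.div_const 3
  set B : ℝ → ℝ≥0∞ := fun x => avgMax f x / 3 with hB
  have meas : ∀ (F : ℝ → ℝ≥0∞) (s : ℝ), Measurable F → Measurable
      (Function.uncurry fun x l => {l : ℝ | ENNReal.ofReal l < F x}.indicator
        (fun l => ENNReal.ofReal (l ^ s)) l) := by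
    intro F s hF
    have : (Function.uncurry fun x l => {l : ℝ | ENNReal.ofReal l < F x}.indicator
        (fun l => ENNReal.ofReal (l ^ s)) l) = {p : ℝ × ℝ | ENNReal.ofReal p.2 < F p.1}.indicator
          (fun p => ENNReal.ofReal (p.2 ^ s)) := by
      funext ⟨x, l⟩; rfl
    rw [this]
    exact Measurable.indicator (by fun_prop) (measurableSet_lt (by fun_prop) (by fun_prop))
  calc ∫⁻ x, B x ^ r ≤ ∫⁻ x, ENNReal.ofReal r * ∫⁻ l in Set.Ioi (0:ℝ),
      {l : ℝ | ENNReal.ofReal l < B x}.indicator (fun l => ENNReal.ofReal (l ^ (r - 1))) l :=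
        lintegral_mono fun x => layer_low r hr _
    _ = ENNReal.ofReal r * ∫⁻ l in Set.Ioi (0:ℝ), ∫⁻ x,
      {l : ℝ | ENNReal.ofReal l < B x}.indicator (fun l => ENNReal.ofReal (l ^ (r - 1))) l := by
        rw [lintegral_const_mul' _ _ ENNReal.ofReal_ne_top,
          lintegral_lintegral_swap (meas B _ hm3).aemeasurable]
    _ ≤ ENNReal.ofReal r * ∫⁻ l in Set.Ioi (0:ℝ), 10 * ∫⁻ x, f x *
      {l : ℝ | ENNReal.ofReal l < f x}.indicator (fun l => ENNReal.ofReal (l ^ (r - 2))) l := by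
        refine mul_le_mul_right (setLIntegral_mono' measurableSet_Ioi fun l hl => ?_) _
        have hl0 : (0:ℝ) < l := hl
        have e1 : ∀ x, {l : ℝ | ENNReal.ofReal l < B x}.indicator
            (fun l => ENNReal.ofReal (l ^ (r - 1))) l =
            {x | ENNReal.ofReal l < B x}.indicator (fun _ => ENNReal.ofReal (l ^ (r - 1))) x :=
          fun x => rfl
        have e2 : ∀ x, f x * {l : ℝ | ENNReal.ofReal l < f x}.indicator
            (fun l => ENNReal.ofReal (l ^ (r - 2))) l =
            ENNReal.ofReal (l ^ (r - 2)) * {x | ENNReal.ofReal l < f x}.indicator f x := by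
          intro x
          by_cases h : ENNReal.ofReal l < f x
          · simp [Set.indicator, h, mul_comm]
          · simp [Set.indicator, h]
        simp_rw [e1, e2]
        rw [lintegral_indicator (show MeasurableSet {x | ENNReal.ofReal l < B x} from
            measurableSet_lt measurable_const hm3), setLIntegral_const,
          lintegral_const_mul' _ _ ENNReal.ofReal_ne_top]
        have e3 : {x | ENNReal.ofReal l < B x} = {x | 3 * ENNReal.ofReal l < avgMax f x} := by
          ext x
          simp only [Set.mem_setOf_eq, hB]
          rw [ENNReal.lt_div_iff_mul_lt (by simp) (by simp), mul_comm]
        have e4 : ENNReal.ofReal (l ^ (r - 1)) =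
            ENNReal.ofReal (l ^ (r - 2)) * ENNReal.ofReal l := by
          rw [← ENNReal.ofReal_mul (by positivity), ← Real.rpow_add_one hl0.ne']
          congr 2; ring
        rw [e3, e4, mul_assoc, mul_left_comm 10]
        exact mul_le_mul_right
          (avgMax_trunc f _ (by simpa using hl0) ENNReal.ofReal_ne_top) _
    _ = ENNReal.ofReal r * (10 * ∫⁻ x, f x * ∫⁻ l in Set.Ioi (0:ℝ),
      {l : ℝ | ENNReal.ofReal l < f x}.indicator (fun l => ENNReal.ofReal (l ^ (r - 2))) l) := by
        rw [lintegral_const_mul' _ _ (by simp)]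
        rw [← lintegral_lintegral_swap]
        · congr 3; funext x
          rw [lintegral_const_mul' _ _ (hft x)]
        · exact ((hf.comp measurable_fst).mul (meas f (r-2) hf)).aemeasurable
    _ ≤ ENNReal.ofReal r * (10 * ∫⁻ x, ENNReal.ofReal (1 / (r - 1)) * f x ^ r) := by
        exact mul_le_mul_right (mul_le_mul_right
          (lintegral_mono fun x => layer_up r hr _ (hft x)) _) _
    _ = _ := by rw [lintegral_const_mul' _ _ ENNReal.ofReal_ne_top]

lemma timeInterval_meas (T : ℝ≥0∞) : MeasurableSet (timeInterval T) :=
  (measurableSet_lt measurable_const measurable_id).inter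
    (measurableSet_lt ENNReal.measurable_ofReal measurable_const)

lemma kernel_summable (c : ℝ) (hc : 0 < c) :
    Summable fun n : ℕ => 2 * ((n : ℝ) + 1) * Real.exp (-(c * n)) := by
  have hq : ‖Real.exp (-c)‖ < 1 := by
    rw [Real.norm_of_nonneg (Real.exp_pos _).le]
    simpa using hc
  have h1 := summable_pow_mul_geometric_of_norm_lt_one 1 hq
  have h0 := summable_pow_mul_geometric_of_norm_lt_one 0 hq
  refine ((h1.add h0).mul_left 2).congr fun n => ?_
  rw [← Real.exp_nat_mul, show (n:ℝ) * -c = -(c * n) by ring]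
  ring

lemma expKernelMax_le (c : ℝ) (hc : 0 < c) (T : ℝ≥0∞) (g : ℝ → ℝ) (hg : Measurable g) (τ : ℝ) :
    expKernelMax c T g τ ≤
      ENNReal.ofReal (∑' n : ℕ, 2 * ((n : ℝ) + 1) * Real.exp (-(c * n))) *
        avgMax ((timeInterval T).indicator fun t => ENNReal.ofReal |g t|) τ := by
  unfold expKernelMax
  split_ifs with hτ
  swap
  · exact zero_le
  refine iSup₂_le fun ρ hρ => ?_
  set F := (timeInterval T).indicator fun t => ENNReal.ofReal |g t| with hF
  have hFm : Measurable F := Measurable.indicator (by fun_prop) (timeInterval_meas T)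
  rw [← lintegral_indicator (timeInterval_meas T)]
  calc _ ≤ ∫⁻ t, ∑' n : ℕ, (Metric.ball τ (((n:ℝ) + 1) / ρ)).indicator
          (fun t => ENNReal.ofReal (ρ * Real.exp (-(c * n))) * F t) t := by
        refine lintegral_mono fun t => ?_
        by_cases ht : t ∈ timeInterval T
        swap
        · rw [Set.indicator_of_notMem ht]; exact zero_le
        rw [Set.indicator_of_mem ht]
        split_ifs with hle
        swap
        · simp
        have hnn : 0 ≤ ρ * (t - τ) := mul_nonneg hρ.le (by linarith)
        have hfl := Nat.floor_le hnn
        have hlt := Nat.lt_floor_add_one (ρ * (t - τ))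
        refine le_trans ?_ (ENNReal.le_tsum ⌊ρ * (t - τ)⌋₊)
        rw [Set.indicator_of_mem, hF, Set.indicator_of_mem ht,
          ← ENNReal.ofReal_mul (by positivity)]
        · apply ENNReal.ofReal_le_ofReal
          have := mul_le_mul_of_nonneg_left hfl hc.le
          refine mul_le_mul_of_nonneg_right (mul_le_mul_of_nonneg_left
            (Real.exp_le_exp.2 ?_) hρ.le) (abs_nonneg _)
          linarith
        · rw [Metric.mem_ball, Real.dist_eq, abs_of_nonneg (by linarith), lt_div_iff₀ hρ]
          linarith
    _ = ∑' n : ℕ, ENNReal.ofReal (ρ * Real.exp (-(c * n))) *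
          ∫⁻ t in Metric.ball τ (((n:ℝ) + 1) / ρ), F t := by
        rw [lintegral_tsum]
        · congr 1; funext n
          rw [lintegral_indicator Metric.isOpen_ball.measurableSet,
            lintegral_const_mul' _ _ ENNReal.ofReal_ne_top]
        · intro n
          exact ((hFm.const_mul _).indicator Metric.isOpen_ball.measurableSet).aemeasurable
    _ ≤ ∑' n : ℕ, ENNReal.ofReal (2 * ((n : ℝ) + 1) * Real.exp (-(c * n))) * avgMax F τ := by
        refine ENNReal.tsum_le_tsum fun n => ?_
        refine (mul_le_mul_right (ball_le_avgMax F τ (((n:ℝ) + 1) / ρ) (by positivity)) _).trans ?_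
        rw [← mul_assoc, ← ENNReal.ofReal_mul (by positivity)]
        apply le_of_eq
        congr 2
        field_simp
    _ = _ := by
        rw [ENNReal.tsum_mul_right, ENNReal.ofReal_tsum_of_nonneg _ (kernel_summable c hc)]
        intro n; positivity

/-- **`L^p` boundedness of the exponential-kernel maximal operator** (Step 2 of the proof of
Proposition `pro-F_heat`). For `c > 0` and `r ∈ (1,∞)` there is `C = C(c,r) > 0` such that for
every `T ∈ (0,∞]` and every measurable `g : ℝ → ℝ`,
`(∫₀^T (Mg)^r)^{1/r} ≤ C (∫₀^T |g|^r)^{1/r}`, as an inequality in `[0,∞]`. -/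
theorem expKernelMax_Lp_bound (c : ℝ) (hc : 0 < c) (r : ℝ) (hr : 1 < r) :
    ∃ C : ℝ, 0 < C ∧
      ∀ T : ℝ≥0∞, 0 < T →
        ∀ g : ℝ → ℝ, Measurable g →
          (∫⁻ τ in timeInterval T, expKernelMax c T g τ ^ r) ^ (1 / r) ≤
            ENNReal.ofReal C *
              (∫⁻ t in timeInterval T, ENNReal.ofReal |g t| ^ r) ^ (1 / r) := by
  have hr0 : 0 < r := by linarith
  have hr1 : 0 < r - 1 := by linarith
  set S := ∑' n : ℕ, 2 * ((n : ℝ) + 1) * Real.exp (-(c * n)) with hS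
  have hS0 : 0 < S :=
    (kernel_summable c hc).tsum_pos (fun n => by positivity) 0 (by positivity)
  set D : ℝ := r * (10 * (1 / (r - 1))) with hD
  have hD0 : 0 < D := by positivity
  refine ⟨S * 3 * D ^ (1 / r), by positivity, fun T _ g hg => ?_⟩
  set F := (timeInterval T).indicator fun t => ENNReal.ofReal |g t| with hF
  have hFm : Measurable F := Measurable.indicator (by fun_prop) (timeInterval_meas T)
  have hFt : ∀ t, F t ≠ ⊤ := by
    intro t
    by_cases ht : t ∈ timeInterval T
    · rw [hF, Set.indicator_of_mem ht]; exact ENNReal.ofReal_ne_top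
    · rw [hF, Set.indicator_of_notMem ht]; exact ENNReal.zero_ne_top
  have hFr : ∫⁻ t, F t ^ r = ∫⁻ t in timeInterval T, ENNReal.ofReal |g t| ^ r := by
    rw [← lintegral_indicator (timeInterval_meas T)]
    congr 1; funext t
    by_cases ht : t ∈ timeInterval T
    · rw [hF, Set.indicator_of_mem ht, Set.indicator_of_mem ht]
    · rw [hF, Set.indicator_of_notMem ht, Set.indicator_of_notMem ht, ENNReal.zero_rpow_of_pos hr0]
  have main : ∫⁻ τ in timeInterval T, expKernelMax c T g τ ^ r ≤
      ENNReal.ofReal (S * 3) ^ r * (ENNReal.ofReal D * ∫⁻ t, F t ^ r) := by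
    calc ∫⁻ τ in timeInterval T, expKernelMax c T g τ ^ r
        ≤ ∫⁻ τ, expKernelMax c T g τ ^ r := setLIntegral_le_lintegral _ _
      _ ≤ ∫⁻ τ, ENNReal.ofReal (S * 3) ^ r * (avgMax F τ / 3) ^ r := by
          refine lintegral_mono fun τ => ?_
          rw [← ENNReal.mul_rpow_of_nonneg _ _ hr0.le]
          refine ENNReal.rpow_le_rpow ((expKernelMax_le c hc T g hg τ).trans (le_of_eq ?_)) hr0.le
          rw [ENNReal.ofReal_mul hS0.le, mul_assoc]
          congr 1
          rw [ENNReal.ofReal_ofNat, ENNReal.mul_div_cancel (by simp) (by simp)]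
      _ ≤ ENNReal.ofReal (S * 3) ^ r * (ENNReal.ofReal D * ∫⁻ t, F t ^ r) := by
          rw [lintegral_const_mul' _ _ (ENNReal.rpow_ne_top_of_nonneg hr0.le ENNReal.ofReal_ne_top)]
          refine mul_le_mul_right ((avgMax_strong r hr F hFm hFt).trans (le_of_eq ?_)) _
          rw [hD, ENNReal.ofReal_mul hr0.le, ENNReal.ofReal_mul (by norm_num), ENNReal.ofReal_ofNat]
          ring
  rw [hFr] at main
  refine (ENNReal.rpow_le_rpow main (by positivity)).trans (le_of_eq ?_)
  rw [ENNReal.mul_rpow_of_nonneg _ _ (by positivity), ENNReal.mul_rpow_of_nonneg _ _ (by positivity),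
    ← ENNReal.rpow_mul, mul_one_div_cancel hr0.ne', ENNReal.rpow_one,
    ENNReal.ofReal_rpow_of_nonneg hD0.le (by positivity), ← mul_assoc,
    ← ENNReal.ofReal_mul (by positivity)]


end
end
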